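/- Let V be a uniformly convex and uniformly smooth Banach space, let f_n, f ∈ C([0,T], V), and suppose (1) ‖f_n(t)‖ converges to ‖f(t)‖ uniformly in t ∈ [0,T], and (2) for every continuous function φ : [0,T] → V', ⟨φ(t), f_n(t)⟩ converges to ⟨φ(t), f(t)⟩ uniformly in t ∈ [0,T]. Then f_n converges to f in the norm of C([0,T], V), i.e. sup_{t∈[0,T]} ‖f_n(t) − f(t)‖ → 0 as n → ∞. -/

import Mathlib

open Filter Topology

/-- A uniform limit that is continuous at `a` is a limit jointly in the index and the point. -/
theorem TendstoUniformly.tendsto_prod_nhds {ι α β : Type*} [TopologicalSpace α] [UniformSpace β]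
    {F : ι → α → β} {f : α → β} {l : Filter ι} {a : α} (h : TendstoUniformly F f l)
    (hf : ContinuousAt f a) :
    Tendsto (fun p : ι × α => F p.1 p.2) (l ×ˢ 𝓝 a) (𝓝 (f a)) := by
  have h' : TendstoUniformly (fun p : ι × α => F p.1) f (l ×ˢ 𝓝 a) :=
    fun s hs => tendsto_fst.eventually (h s hs)
  exact h'.tendsto_comp hf tendsto_snd

/-- **Radon–Riesz property**: in a uniformly convex space, convergence of the norms together with
weak convergence implies norm convergence. -/
theorem UniformConvexSpace.tendsto_of_tendsto_norm_of_tendsto_dual {ι V : Type*}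
    [NormedAddCommGroup V] [NormedSpace ℝ V] [UniformConvexSpace V] {l : Filter ι} {u : ι → V}
    {x : V} (hnorm : Tendsto (fun i => ‖u i‖) l (𝓝 ‖x‖))
    (hweak : ∀ φ : V →L[ℝ] ℝ, Tendsto (fun i => φ (u i)) l (𝓝 (φ x))) :
    Tendsto u l (𝓝 x) := by
  rcases eq_or_ne x 0 with rfl | hx
  · exact tendsto_zero_iff_norm_tendsto_zero.2 (by simpa using hnorm)
  have hx' : ‖x‖ ≠ 0 := norm_ne_zero_iff.2 hx
  have hu : ∀ᶠ i in l, ‖u i‖ ≠ 0 := hnorm.eventually_ne hx'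
  obtain ⟨φ, hφ, hφx⟩ := exists_dual_vector'' ℝ x
  simp only [RCLike.ofReal_real_eq_id, id_eq] at hφx
  have hlim : Tendsto (fun i => φ (‖u i‖⁻¹ • u i + ‖x‖⁻¹ • x)) l (𝓝 2) := by
    have h := ((hnorm.inv₀ hx').mul (hweak φ)).add_const (‖x‖⁻¹ * φ x)
    rw [hφx, inv_mul_cancel₀ hx', one_add_one_eq_two] at h
    simpa [hφx, hx'] using h
  have hunit : Tendsto (fun i => ‖u i‖⁻¹ • u i) l (𝓝 (‖x‖⁻¹ • x)) := by
    refine Metric.tendsto_nhds.2 fun ε hε => ?_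
    obtain ⟨δ, hδ, h⟩ := UniformConvexSpace.uniform_convex (E := V) hε
    filter_upwards [hu, hlim.eventually_const_lt (sub_lt_self 2 hδ)] with i hi hlt
    rw [dist_eq_norm]
    by_contra! hge
    have hle := h (by simp [norm_smul, hi]) (by simp [norm_smul, hx']) hge
    have hop : φ (‖u i‖⁻¹ • u i + ‖x‖⁻¹ • x) ≤ ‖‖u i‖⁻¹ • u i + ‖x‖⁻¹ • x‖ :=
      (le_abs_self _).trans (φ.le_of_opNorm_le_of_le hφ le_rfl |>.trans_eq (one_mul _))
    linarith
  have h := hnorm.smul hunit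
  rw [smul_inv_smul₀ hx'] at h
  refine h.congr' ?_
  filter_upwards [hu] with i hi
  exact smul_inv_smul₀ hi _

theorem stmt_1 (V : Type*) [NormedAddCommGroup V] [NormedSpace ℝ V] [CompleteSpace V]
    (hucv : ∀ ε : ℝ, 0 < ε → ∃ δ : ℝ, 0 < δ ∧ ∀ x y : V, ‖x‖ = ‖y‖ → ‖y‖ ≤ 1 →
      ε ≤ ‖x - y‖ → ‖(1/2 : ℝ) • (x + y)‖ ≤ 1 - δ)
    (husm : ∀ ε : ℝ, 0 < ε → ∃ δ : ℝ, 0 < δ ∧ ∀ x y : V, ‖x‖ = 1 → ‖y‖ ≤ δ →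
      ‖x + y‖ + ‖x - y‖ ≤ 2 + ε * ‖y‖)
    (T : ℝ) (hT : 0 < T)
    (fn : ℕ → C(Set.Icc (0:ℝ) T, V)) (f : C(Set.Icc (0:ℝ) T, V))
    (h1 : TendstoUniformly (fun n t => ‖fn n t‖) (fun t => ‖f t‖) Filter.atTop)
    (h2 : ∀ φ : C(Set.Icc (0:ℝ) T, V →L[ℝ] ℝ),
      TendstoUniformly (fun n t => φ t (fn n t)) (fun t => φ t (f t)) Filter.atTop) :
    Filter.Tendsto (fun n => ‖fn n - f‖) Filter.atTop (nhds 0) := by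
  have : UniformConvexSpace V := ⟨fun ε hε => by
    obtain ⟨δ, hδ, h⟩ := hucv ε hε
    refine ⟨2 * δ, by positivity, fun x hx y hy hxy => ?_⟩
    have hle := h x y (hx.trans hy.symm) hy.le hxy
    rw [norm_smul] at hle
    norm_num at hle
    linarith⟩
  have hlim (t₀ : Set.Icc (0:ℝ) T) :
      Tendsto (fun p : ℕ × Set.Icc (0:ℝ) T => fn p.1 p.2) (atTop ×ˢ 𝓝 t₀) (𝓝 (f t₀)) := by
    refine UniformConvexSpace.tendsto_of_tendsto_norm_of_tendsto_dual ?_ fun φ => ?_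
    · exact h1.tendsto_prod_nhds f.continuous.norm.continuousAt
    · exact (h2 (.const _ φ)).tendsto_prod_nhds (φ.continuous.comp f.continuous).continuousAt
  rw [← tendsto_iff_norm_sub_tendsto_zero, ContinuousMap.tendsto_iff_tendstoUniformly,
    ← tendstoLocallyUniformly_iff_tendstoUniformly_of_compactSpace,
    tendstoLocallyUniformly_iff_forall_tendsto]
  intro t₀
  exact (((f.continuous.tendsto t₀).comp tendsto_snd).prodMk_nhds (hlim t₀)).mono_right
    (nhds_le_uniformity _)
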